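/- Suppose α̇·β − α·β̇ > 0. Then the marginal velocity u is differentiable on ℝ^d and its divergence is bounded below by the constant (β̇/β)·d: for every x ∈ ℝ^d, div u(x) ≥ (β̇/β)·d, where div u(x) denotes the trace of the Fréchet derivative of u at x. (This follows from the divergence identity for the posterior mean-squared discrepancy, since that discrepancy is nonnegative.) -/

import Mathlib

open MeasureTheory

theorem aux_integrable {E : Type*} [NormedAddCommGroup E] [InnerProductSpace ℝ E]
    [FiniteDimensional ℝ E] [MeasurableSpace E] [BorelSpace E]
    {G : Type*} [NormedAddCommGroup G] [NormedSpace ℝ G]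
    (μ : Measure (E)) [IsProbabilityMeasure μ]
    (K : Set (E)) (hK : IsCompact K) (hμK : μ Kᶜ = 0)
    (F : E → G) (hF : Continuous F) : Integrable F μ := by
  obtain ⟨M, hM⟩ := hK.exists_bound_of_continuousOn hF.continuousOn
  have hae : ∀ᵐ y ∂μ, y ∈ K := hμK
  refine Integrable.of_bound ?_ M (hae.mono hM)
  exact hF.aestronglyMeasurable

theorem aux_fderiv {E : Type*} [NormedAddCommGroup E] [InnerProductSpace ℝ E]
    [FiniteDimensional ℝ E] [MeasurableSpace E] [BorelSpace E]
    {G : Type*} [NormedAddCommGroup G] [NormedSpace ℝ G]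
    (μ : Measure (E)) [IsProbabilityMeasure μ]
    (K : Set (E)) (hK : IsCompact K) (hμK : μ Kᶜ = 0) (a : ℝ)
    (F : E → G) (hF : Continuous F) (x₀ : E) :
    ∃ L : E →L[ℝ] G,
      HasFDerivAt (fun x => ∫ y, Real.exp (a * inner ℝ y x) • F y ∂μ) L x₀ ∧
      ∀ w, L w = ∫ y, (Real.exp (a * inner ℝ y x₀) * (a * inner ℝ y w)) • F y ∂μ := by
  let F' : E → E →
      (E →L[ℝ] G) := fun x y =>
    (Real.exp (a * inner ℝ y x) • (a • innerSL ℝ y)).smulRight (F y)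
  have hF'c : Continuous (fun q : E × E =>
      F' q.1 q.2) := by
    have : Continuous (fun q : E × E =>
      ContinuousLinearMap.smulRightL ℝ (E) G
        (Real.exp (a * inner ℝ q.2 q.1) • (a • innerSL ℝ q.2)) (F q.2)) := by
      fun_prop
    exact this
  have hF'i : ∀ x, Integrable (F' x) μ := fun x =>
    aux_integrable μ K hK hμK _ (hF'c.comp (by fun_prop : Continuous fun y => (x, y)))
  obtain ⟨M, hM⟩ := ((isCompact_closedBall x₀ 1).prod hK).exists_bound_of_continuousOn
    hF'c.continuousOn
  have hae : ∀ᵐ y ∂μ, y ∈ K := hμK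
  refine ⟨∫ y, F' x₀ y ∂μ, ?_, ?_⟩
  · refine hasFDerivAt_integral_of_dominated_of_fderiv_le (bound := fun _ => M)
      (Metric.closedBall_mem_nhds x₀ one_pos) ?_ ?_ (hF'i x₀).aestronglyMeasurable ?_
      (integrable_const M) ?_
    · exact Filter.Eventually.of_forall fun x =>
        (aux_integrable μ K hK hμK _ (by fun_prop)).aestronglyMeasurable
    · exact aux_integrable μ K hK hμK _ (by fun_prop)
    · filter_upwards [hae] with y hy x hx
      exact hM (x, y) ⟨hx, hy⟩
    · refine Filter.Eventually.of_forall fun y x _ => ?_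
      have h1 : HasFDerivAt (fun x => a * inner ℝ y x) (a • innerSL ℝ y) x :=
        ((innerSL ℝ y).hasFDerivAt (x := x)).const_mul a
      exact h1.exp.smul_const (F y)
  · intro w
    rw [ContinuousLinearMap.integral_apply (hF'i x₀)]
    rfl

theorem aux_cs {d : ℕ}
    (μ : Measure (EuclideanSpace ℝ (Fin d))) [IsProbabilityMeasure μ]
    (K : Set (EuclideanSpace ℝ (Fin d))) (hK : IsCompact K) (hμK : μ Kᶜ = 0)
    (e f : EuclideanSpace ℝ (Fin d) → ℝ) (he : Continuous e) (hf : Continuous f)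
    (he0 : ∀ y, 0 ≤ e y) (hP : 0 < ∫ y, e y ∂μ) :
    (∫ y, e y * f y ∂μ) ^ 2 ≤ (∫ y, e y ∂μ) * ∫ y, e y * f y ^ 2 ∂μ := by
  set P := ∫ y, e y ∂μ with hPd
  set A := ∫ y, e y * f y ∂μ with hA
  set B := ∫ y, e y * f y ^ 2 ∂μ with hB
  have h0 : 0 ≤ ∫ y, e y * (P * f y - A) ^ 2 ∂μ :=
    integral_nonneg fun y => mul_nonneg (he0 y) (sq_nonneg _)
  have h1 : ∫ y, e y * (P * f y - A) ^ 2 ∂μ = P ^ 2 * B - 2 * P * A * A + A ^ 2 * P := by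
    have : (fun y => e y * (P * f y - A) ^ 2) =
        fun y => P ^ 2 * (e y * f y ^ 2) - 2 * P * A * (e y * f y) + A ^ 2 * e y := by
      funext y; ring
    have i1 := aux_integrable μ K hK hμK (fun y => P ^ 2 * (e y * f y ^ 2)) (by fun_prop)
    have i2 := aux_integrable μ K hK hμK (fun y => 2 * P * A * (e y * f y)) (by fun_prop)
    have i3 := aux_integrable μ K hK hμK (fun y => A ^ 2 * e y) (by fun_prop)
    have i12 : Integrable (fun y => P ^ 2 * (e y * f y ^ 2) - 2 * P * A * (e y * f y)) μ := i1.sub i2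
    rw [this, integral_add i12 i3, integral_sub i1 i2, integral_const_mul,
      integral_const_mul, integral_const_mul]
  rw [h1] at h0
  have : 0 ≤ P * (P * B - A ^ 2) := by linarith
  have := nonneg_of_mul_nonneg_right this hP
  linarith

/-- Suppose `α̇·β − α·β̇ > 0`. Then the marginal velocity `u` is
differentiable on ℝ^d and its divergence is bounded below by `(β̇/β)·d`: for every `x`,
`div u x ≥ (β̇/β)·d`, where `div u x` is the trace of the Fréchet derivative of `u`. -/
theorem stmt_11
    (d : ℕ) (hd : 1 ≤ d)
    (α β αdot βdot : ℝ) (hα : 0 < α) (hβ : 0 < β)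
    (μ : Measure (EuclideanSpace ℝ (Fin d))) [IsProbabilityMeasure μ]
    (K : Set (EuclideanSpace ℝ (Fin d))) (hK : IsCompact K) (hμK : μ Kᶜ = 0)
    (g : EuclideanSpace ℝ (Fin d) → EuclideanSpace ℝ (Fin d) → ℝ)
    (hg : ∀ x y, g x y =
      (2 * Real.pi * β ^ 2) ^ (-(d : ℝ) / 2) * Real.exp (-‖x - α • y‖ ^ 2 / (2 * β ^ 2)))
    (p : EuclideanSpace ℝ (Fin d) → ℝ)
    (hp : ∀ x, p x = ∫ y, g x y ∂μ)
    (hppos : ∀ x, 0 < p x)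
    (v : EuclideanSpace ℝ (Fin d) → EuclideanSpace ℝ (Fin d) → EuclideanSpace ℝ (Fin d))
    (hv : ∀ x y, v x y = αdot • y + (βdot / β) • (x - α • y))
    (u : EuclideanSpace ℝ (Fin d) → EuclideanSpace ℝ (Fin d))
    (hu : ∀ x, u x = (p x)⁻¹ • ∫ y, g x y • v x y ∂μ)
    (hpos : 0 < αdot * β - α * βdot) :
    Differentiable ℝ u ∧
      ∀ x, (βdot / β) * (d : ℝ) ≤
        LinearMap.trace ℝ (EuclideanSpace ℝ (Fin d)) (fderiv ℝ u x).toLinearMap := by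
  set a : ℝ := α / β ^ 2 with ha
  have ha0 : 0 < a := by positivity
  set c : ℝ := βdot / β with hc
  set k : ℝ := αdot - c * α with hk
  have hk0 : 0 < k := by
    have : k = (αdot * β - α * βdot) / β := by rw [hk, hc]; field_simp
    rw [this]; positivity
  let W : EuclideanSpace ℝ (Fin d) → ℝ := fun y => Real.exp (-(α ^ 2 * ‖y‖ ^ 2) / (2 * β ^ 2))
  have hW : Continuous W := by fun_prop
  let C : EuclideanSpace ℝ (Fin d) → ℝ := fun x =>
    (2 * Real.pi * β ^ 2) ^ (-(d : ℝ) / 2) * Real.exp (-‖x‖ ^ 2 / (2 * β ^ 2))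
  have hC : ∀ x, 0 < C x := fun x => by positivity
  have hgC : ∀ x y, g x y = C x * (Real.exp (a * inner ℝ y x) * W y) := by
    intro x y
    simp only [hg, C, W]
    rw [mul_assoc (_ ^ (_ : ℝ)), ← Real.exp_add, ← Real.exp_add]
    congr 2
    rw [norm_sub_sq_real, norm_smul, real_inner_smul_right, real_inner_comm, ha, mul_pow,
      Real.norm_eq_abs, sq_abs]
    field_simp
    ring
  let P : EuclideanSpace ℝ (Fin d) → ℝ := fun x => ∫ y, Real.exp (a * inner ℝ y x) • W y ∂μ
  let N : EuclideanSpace ℝ (Fin d) → EuclideanSpace ℝ (Fin d) :=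
    fun x => ∫ y, Real.exp (a * inner ℝ y x) • (W y • y) ∂μ
  have hpP : ∀ x, p x = C x * P x := by
    intro x
    simp only [hp, hgC, P, smul_eq_mul]
    rw [integral_const_mul]
  have hP0 : ∀ x, 0 < P x := fun x => by
    have := hppos x
    rw [hpP] at this
    exact pos_of_mul_pos_right this (hC x).le
  have huN : ∀ x, u x = k • ((P x)⁻¹ • N x) + c • x := by
    intro x
    have h1 : ∫ y, g x y • v x y ∂μ = C x • (k • N x + (P x) • (c • x)) := by
      have i1 := aux_integrable μ K hK hμK
        (fun y => k • (Real.exp (a * inner ℝ y x) • (W y • y))) (by fun_prop)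
      have i2 := aux_integrable μ K hK hμK
        (fun y => (Real.exp (a * inner ℝ y x) • W y) • (c • x)) (by fun_prop)
      simp only [P, N]
      rw [← integral_smul, ← integral_smul_const, ← integral_add i1 i2, ← integral_smul]
      congr 1
      funext y
      rw [hgC, hv, hk]
      simp only [smul_eq_mul]
      module
    rw [hu, h1, hpP]
    have h2 := (hC x).ne'
    have h3 := (hP0 x).ne'
    rw [smul_smul, smul_add, smul_smul, smul_smul, smul_smul, smul_smul]
    congr 2 <;> field_simp
  have key : ∀ x, ∃ L : EuclideanSpace ℝ (Fin d) →L[ℝ] EuclideanSpace ℝ (Fin d),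
      HasFDerivAt u L x ∧ ∀ w, c * ‖w‖ ^ 2 ≤ inner ℝ w (L w) := by
    intro x
    obtain ⟨LP, hLP, hLPw⟩ := aux_fderiv μ K hK hμK a W hW x
    obtain ⟨LN, hLN, hLNw⟩ := aux_fderiv μ K hK hμK a (fun y => W y • y) (by fun_prop) x
    have hinv : HasFDerivAt (fun x => (P x)⁻¹) (-((P x ^ 2)⁻¹) • LP) x :=
      (hasDerivAt_inv (hP0 x).ne').comp_hasFDerivAt x hLP
    have hd1 := ((hinv.smul hLN).const_smul k).add ((hasFDerivAt_id x).const_smul c)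
    refine ⟨_, hd1.congr_of_eventuallyEq (Filter.Eventually.of_forall huN), ?_⟩
    intro w
    let e : EuclideanSpace ℝ (Fin d) → ℝ := fun y => Real.exp (a * inner ℝ y x) * W y
    let f : EuclideanSpace ℝ (Fin d) → ℝ := fun y => inner ℝ w y
    have he : Continuous e := by fun_prop
    have hf : Continuous f := by fun_prop
    have hcs := aux_cs μ K hK hμK e f he hf (fun y => by positivity) (hP0 x)
    have e1 : LP w = a * ∫ y, e y * f y ∂μ := by
      rw [hLPw, ← integral_const_mul]
      congr 1
      funext y
      simp only [e, f, smul_eq_mul, real_inner_comm]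
      ring
    have e2 : inner ℝ w (LN w) = a * ∫ y, e y * f y ^ 2 ∂μ := by
      rw [hLNw, ← integral_inner (aux_integrable μ K hK hμK _ (by fun_prop)),
        ← integral_const_mul]
      congr 1
      funext y
      simp only [e, f, real_inner_smul_right, real_inner_comm]
      ring
    have e3 : inner ℝ w (N x) = ∫ y, e y * f y ∂μ := by
      simp only [N]
      rw [← integral_inner (aux_integrable μ K hK hμK _ (by fun_prop))]
      congr 1
      funext y
      simp only [e, f, real_inner_smul_right]
      ring
    have hPx : P x = ∫ y, e y ∂μ := rfl
    have hval : inner ℝ w ((k • ((P x)⁻¹ • LN + (-((P x ^ 2)⁻¹) • LP).smulRight (N x)) +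
        c • ContinuousLinearMap.id ℝ (EuclideanSpace ℝ (Fin d))) w) =
        k * ((P x)⁻¹ * inner ℝ w (LN w) - (P x ^ 2)⁻¹ * LP w * inner ℝ w (N x)) +
          c * ‖w‖ ^ 2 := by
      simp [inner_add_right, real_inner_smul_right, inner_neg_right]
      ring
    refine le_of_le_of_eq ?_ hval.symm
    rw [e1, e2, e3]
    rw [← hPx] at hcs
    have hPp := hP0 x
    set A := ∫ y, e y * f y ∂μ
    set B := ∫ y, e y * f y ^ 2 ∂μ
    have : (P x)⁻¹ * (a * B) - (P x ^ 2)⁻¹ * (a * A) * A =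
        a * (P x ^ 2)⁻¹ * (P x * B - A ^ 2) := by
      field_simp
    rw [this]
    have : 0 ≤ k * (a * (P x ^ 2)⁻¹ * (P x * B - A ^ 2)) :=
      mul_nonneg hk0.le (mul_nonneg (by positivity) (by linarith))
    linarith
  refine ⟨fun x => ?_, fun x => ?_⟩
  · obtain ⟨L, hL, _⟩ := key x
    exact hL.differentiableAt
  · obtain ⟨L, hL, hLw⟩ := key x
    rw [hL.fderiv, LinearMap.trace_eq_sum_inner _ (EuclideanSpace.basisFun (Fin d) ℝ)]
    calc c * (d : ℝ) = ∑ i : Fin d, c * ‖EuclideanSpace.basisFun (Fin d) ℝ i‖ ^ 2 := by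
          simp [mul_comm]
      _ ≤ _ := Finset.sum_le_sum fun i _ => hLw _
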